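/- Let u and ψ be entire functions on ℂ such that the weighted composition operator W_{(u,ψ)} is bounded on the Fock space 𝓕₂. Then W_{(u,ψ)} is not hypercyclic on 𝓕₂; that is, there is no f ∈ 𝓕₂ whose orbit {W_{(u,ψ)}ⁿ f : n ≥ 0} is dense in 𝓕₂. -/

import Mathlib

open MeasureTheory Finset

/-- Squared Fock-space norm: ‖f‖₂² = (1/π)∫_ℂ |f(z)|² e^{-|z|²} dA(z). -/
noncomputable def fockNormSq (f : ℂ → ℂ) : ℝ :=
  (1 / Real.pi) * ∫ z : ℂ, ‖f z‖ ^ 2 * Real.exp (-‖z‖ ^ 2)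

/-- Membership in the Fock space 𝓕₂: entire and square Gaussian-integrable. -/
def MemFock (f : ℂ → ℂ) : Prop :=
  Differentiable ℂ f ∧
  Integrable (fun z : ℂ => ‖f z‖ ^ 2 * Real.exp (-‖z‖ ^ 2))

/-- Fock-space inner product ⟨f,g⟩ = (1/π)∫_ℂ f(z)·conj(g(z))·e^{-|z|²} dA(z). -/
noncomputable def fockInner (f g : ℂ → ℂ) : ℂ :=
  (1 / (Real.pi : ℂ)) * ∫ z : ℂ, f z * (starRingEnd ℂ) (g z) * (Real.exp (-‖z‖ ^ 2) : ℂ)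

/-- Reproducing kernel of the Fock space: K_w(z) = e^{z·conj(w)}. -/
noncomputable def fockKernel (w : ℂ) : ℂ → ℂ :=
  fun z => Complex.exp (z * (starRingEnd ℂ) w)

/-- Weighted composition operator W_{(u,ψ)} f = u·(f∘ψ). -/
def wComp (u ψ : ℂ → ℂ) (f : ℂ → ℂ) : ℂ → ℂ := fun z => u z * f (ψ z)

/-- Composition operator C_ψ f = f∘ψ. -/
def compOp (ψ : ℂ → ℂ) (f : ℂ → ℂ) : ℂ → ℂ := fun z => f (ψ z)

/-- Multiplication operator M_u f = u·f. -/
def mulOp (u : ℂ → ℂ) (f : ℂ → ℂ) : ℂ → ℂ := fun z => u z * f z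

/-- T maps 𝓕₂ into 𝓕₂ and is bounded there. -/
def FockBoundedOp (T : (ℂ → ℂ) → ℂ → ℂ) : Prop :=
  (∀ f, MemFock f → MemFock (T f)) ∧
  ∃ C : ℝ, 0 ≤ C ∧ ∀ f, MemFock f → fockNormSq (T f) ≤ C * fockNormSq f

/-- f is a cyclic vector for T on 𝓕₂: the linear span of the orbit
{Tⁿ f : n ≥ 0} is dense in 𝓕₂. -/
def IsCyclicVec (T : (ℂ → ℂ) → ℂ → ℂ) (f : ℂ → ℂ) : Prop :=
  MemFock f ∧ ∀ g, MemFock g → ∀ ε : ℝ, 0 < ε →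
    ∃ (n : ℕ) (c : Fin n → ℂ),
      fockNormSq (fun z => (∑ i : Fin n, c i * T^[(i : ℕ)] f z) - g z) < ε

/-- T is cyclic on 𝓕₂. -/
def IsCyclicOp (T : (ℂ → ℂ) → ℂ → ℂ) : Prop := ∃ f, IsCyclicVec T f

/-- T is hypercyclic on 𝓕₂: some orbit {Tⁿ f : n ≥ 0} is dense. -/
def IsHypercyclicOp (T : (ℂ → ℂ) → ℂ → ℂ) : Prop :=
  ∃ f, MemFock f ∧ ∀ g, MemFock g → ∀ ε : ℝ, 0 < ε →
    ∃ n : ℕ, fockNormSq (fun z => T^[n] f z - g z) < ε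

/-- T is supercyclic on 𝓕₂: some projective orbit {λTⁿ f} is dense. -/
def IsSupercyclicOp (T : (ℂ → ℂ) → ℂ → ℂ) : Prop :=
  ∃ f, MemFock f ∧ ∀ g, MemFock g → ∀ ε : ℝ, 0 < ε →
    ∃ (lam : ℂ) (n : ℕ), fockNormSq (fun z => lam * T^[n] f z - g z) < ε

/-- T is invertible as a bounded operator on 𝓕₂. -/
def FockOpInvertible (T : (ℂ → ℂ) → ℂ → ℂ) : Prop :=
  (∀ f, MemFock f → MemFock (T f)) ∧
  ∃ S : (ℂ → ℂ) → ℂ → ℂ,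
    (∀ f, MemFock f → MemFock (S f)) ∧
    (∀ f, MemFock f → S (T f) = f) ∧
    (∀ f, MemFock f → T (S f) = f) ∧
    ∃ C : ℝ, 0 ≤ C ∧ ∀ f, MemFock f → fockNormSq (S f) ≤ C * fockNormSq f

/-- μ is an eigenvalue of the Hilbert-space adjoint W_{(u,ψ)}*, expressed via the
inner product: W* g = μ g for a nonzero g ∈ 𝓕₂, i.e. ⟨Wf, g⟩ = conj(μ)·⟨f, g⟩
for all f ∈ 𝓕₂. -/
def IsAdjointEigenvalue (u ψ : ℂ → ℂ) (μ : ℂ) : Prop :=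
  ∃ g, MemFock g ∧ g ≠ 0 ∧ ∀ f, MemFock f →
    fockInner (wComp u ψ f) g = (starRingEnd ℂ) μ * fockInner f g

open scoped ENNReal

/-- Submean value property of `‖h‖` against a radial weight. -/
theorem enorm_apply_zero_mul_lintegral_radial_le {h : ℂ → ℂ} (hh : Differentiable ℂ h)
    {k : ℝ → ℝ≥0∞} (hk : Measurable k) :
    ‖h 0‖ₑ * ∫⁻ z : ℂ, k ‖z‖ ≤ ∫⁻ z : ℂ, ‖h z‖ₑ * k ‖z‖ := by
  have hcont := hh.continuous
  rw [← Complex.lintegral_comp_polarCoord_symm, ← Complex.lintegral_comp_polarCoord_symm,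
    polarCoord_target, Measure.volume_eq_prod, ← Measure.prod_restrict]
  have hsymm : Measurable (fun p : ℝ × ℝ => Complex.polarCoord.symm p) := by
    simp only [Complex.polarCoord_symm_apply]
    fun_prop
  have hknorm : Measurable (fun p : ℝ × ℝ => k ‖Complex.polarCoord.symm p‖) :=
    hk.comp hsymm.norm
  have hhnorm : Measurable (fun p : ℝ × ℝ => ‖h (Complex.polarCoord.symm p)‖ₑ) :=
    (hcont.measurable.comp hsymm).enorm
  simp only [smul_eq_mul]
  rw [lintegral_prod _ (by fun_prop), lintegral_prod _ (by fun_prop),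
    ← lintegral_const_mul _ (by fun_prop)]
  refine lintegral_mono fun r => ?_
  simp only [Complex.norm_polarCoord_symm]
  have hcirc (θ : ℝ) : Complex.polarCoord.symm (r, θ) = circleMap 0 r θ := by
    simp [Complex.polarCoord_symm_apply, circleMap, Complex.exp_mul_I]
  simp only [hcirc, lintegral_const, Measure.restrict_apply_univ, Real.volume_Ioo]
  have hmean : ‖h 0‖ₑ * ENNReal.ofReal (Real.pi - -Real.pi) ≤
      ∫⁻ θ in Set.Ioo (-Real.pi) Real.pi, ‖h (circleMap 0 r θ)‖ₑ := by
    have h1 : (∫ θ in Set.Ioo (-Real.pi) Real.pi, h (circleMap 0 r θ)) =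
        ((2 * Real.pi : ℝ) : ℂ) * h 0 := by
      have h2 := (hh.diffContOnCl (s := Metric.ball 0 |r|)).circleAverage
      rw [Real.circleAverage_eq_integral_add (-Real.pi),
        intervalIntegral.integral_comp_add_right (fun θ ↦ h (circleMap 0 r θ)),
        intervalIntegral.integral_of_le (by linarith [Real.pi_pos]),
        integral_Ioc_eq_integral_Ioo] at h2
      rw [← h2, show (0 : ℝ) + -Real.pi = -Real.pi by ring,
        show 2 * Real.pi + -Real.pi = Real.pi by ring, Complex.real_smul, ← mul_assoc,
        ← Complex.ofReal_mul, mul_inv_cancel₀ Real.two_pi_pos.ne']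
      simp
    calc ‖h 0‖ₑ * ENNReal.ofReal (Real.pi - -Real.pi)
        = ‖((2 * Real.pi : ℝ) : ℂ) * h 0‖ₑ := by
          rw [enorm_mul, mul_comm, ← ofReal_norm ((2 * Real.pi : ℝ) : ℂ),
            Complex.norm_real, Real.norm_of_nonneg Real.two_pi_pos.le]
          congr 2
          ring
      _ ≤ _ := by
          rw [← h1]
          exact enorm_integral_le_lintegral_enorm _
  have hmeas : Measurable fun θ : ℝ => ‖h (circleMap 0 r θ)‖ₑ :=
    (hcont.comp (continuous_circleMap 0 r)).measurable.enorm
  rw [lintegral_const_mul _ (hmeas.mul_const _), lintegral_mul_const _ hmeas]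
  calc _ = ENNReal.ofReal r * (‖h 0‖ₑ * ENNReal.ofReal (Real.pi - -Real.pi) * k |r|) := by ring
    _ ≤ _ := by gcongr

theorem fockNormSq_nonneg (f : ℂ → ℂ) : 0 ≤ fockNormSq f := by
  unfold fockNormSq
  positivity

theorem integral_exp_neg_norm_sq : ∫ z : ℂ, Real.exp (-‖z‖ ^ 2) = Real.pi := by
  simpa using GaussianFourier.integral_rexp_neg_mul_sq_norm (V := ℂ) one_pos

theorem integrable_exp_neg_norm_sq : Integrable fun z : ℂ => Real.exp (-‖z‖ ^ 2) :=
  .of_integral_ne_zero (integral_exp_neg_norm_sq ▸ Real.pi_ne_zero)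

theorem memFock_const (c : ℂ) : MemFock fun _ => c :=
  ⟨differentiable_const c, integrable_exp_neg_norm_sq.const_mul _⟩

theorem fockNormSq_const (c : ℂ) : fockNormSq (fun _ => c) = ‖c‖ ^ 2 := by
  rw [fockNormSq, integral_const_mul, integral_exp_neg_norm_sq]
  field_simp

theorem MemFock.sub {f g : ℂ → ℂ} (hf : MemFock f) (hg : MemFock g) :
    MemFock fun z => f z - g z := by
  refine ⟨hf.1.sub hg.1, ((hf.2.const_mul 2).add (hg.2.const_mul 2)).mono' ?_ (.of_forall ?_)⟩
  · have := hf.1.continuous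
    have := hg.1.continuous
    fun_prop
  · intro z
    rw [Real.norm_of_nonneg (by positivity)]
    have : ‖f z - g z‖ ^ 2 ≤ 2 * ‖f z‖ ^ 2 + 2 * ‖g z‖ ^ 2 := by
      nlinarith [norm_sub_le (f z) (g z), norm_nonneg (f z - g z), sq_nonneg (‖f z‖ - ‖g z‖)]
    calc _ ≤ (2 * ‖f z‖ ^ 2 + 2 * ‖g z‖ ^ 2) * Real.exp (-‖z‖ ^ 2) := by gcongr
      _ = _ := by simp only [Pi.add_apply]; ring

theorem MemFock.sq_norm_apply_zero_le {f : ℂ → ℂ} (hf : MemFock f) :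
    ‖f 0‖ ^ 2 ≤ fockNormSq f := by
  have h1 := enorm_apply_zero_mul_lintegral_radial_le (hf.1.pow 2)
    (k := fun r => ENNReal.ofReal (Real.exp (-r ^ 2))) (by fun_prop)
  have h2 (z : ℂ) : ‖(f ^ 2) z‖ₑ * ENNReal.ofReal (Real.exp (-‖z‖ ^ 2)) =
      ENNReal.ofReal (‖f z‖ ^ 2 * Real.exp (-‖z‖ ^ 2)) := by
    rw [ENNReal.ofReal_mul (by positivity), ← ofReal_norm]
    simp
  simp only [h2] at h1
  rw [← ofReal_integral_eq_lintegral_ofReal hf.2 (.of_forall fun z => by positivity),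
    ← ofReal_integral_eq_lintegral_ofReal integrable_exp_neg_norm_sq
      (.of_forall fun z => by positivity), integral_exp_neg_norm_sq, ← ofReal_norm,
    ← ENNReal.ofReal_mul (by positivity), ENNReal.ofReal_le_ofReal_iff (by positivity)] at h1
  simp only [Pi.pow_apply, norm_pow] at h1
  rw [fockNormSq, one_div_mul_eq_div, le_div_iff₀ Real.pi_pos]
  exact h1

/-- The unnormalized Weyl translation `f ↦ f (· + w) e^{-z conj w}` of the Fock space. -/
noncomputable def fockWeyl (w : ℂ) (f : ℂ → ℂ) : ℂ → ℂ :=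
  fun z => f (z + w) * Complex.exp (-(z * (starRingEnd ℂ) w))

theorem sq_norm_fockWeyl_mul_exp (w : ℂ) (f : ℂ → ℂ) (z : ℂ) :
    ‖fockWeyl w f z‖ ^ 2 * Real.exp (-‖z‖ ^ 2) =
      Real.exp (‖w‖ ^ 2) * (‖f (z + w)‖ ^ 2 * Real.exp (-‖z + w‖ ^ 2)) := by
  have h : Real.exp (-(z * (starRingEnd ℂ) w).re) ^ 2 * Real.exp (-‖z‖ ^ 2) =
      Real.exp (‖w‖ ^ 2) * Real.exp (-‖z + w‖ ^ 2) := by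
    rw [← Real.exp_nat_mul, ← Real.exp_add, ← Real.exp_add]
    congr 1
    simp only [Complex.sq_norm, Complex.normSq_apply, Complex.mul_re, Complex.conj_re,
      Complex.conj_im, Complex.add_re, Complex.add_im]
    push_cast
    ring
  rw [fockWeyl, norm_mul, Complex.norm_exp, mul_pow, Complex.neg_re, mul_assoc, h]
  ring

theorem MemFock.fockWeyl {f : ℂ → ℂ} (hf : MemFock f) (w : ℂ) : MemFock (fockWeyl w f) := by
  refine ⟨?_, ?_⟩
  · have := hf.1
    unfold _root_.fockWeyl
    fun_prop
  · simp only [sq_norm_fockWeyl_mul_exp]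
    exact (hf.2.comp_add_right w).const_mul _

theorem fockNormSq_fockWeyl (w : ℂ) (f : ℂ → ℂ) :
    fockNormSq (fockWeyl w f) = Real.exp (‖w‖ ^ 2) * fockNormSq f := by
  simp only [fockNormSq, sq_norm_fockWeyl_mul_exp]
  rw [integral_const_mul,
    integral_add_right_eq_self (fun z : ℂ => ‖f z‖ ^ 2 * Real.exp (-‖z‖ ^ 2)) w]
  ring

theorem MemFock.sq_norm_apply_le {f : ℂ → ℂ} (hf : MemFock f) (w : ℂ) :
    ‖f w‖ ^ 2 ≤ Real.exp (‖w‖ ^ 2) * fockNormSq f := by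
  simpa [fockNormSq_fockWeyl, _root_.fockWeyl] using (hf.fockWeyl w).sq_norm_apply_zero_le

theorem fockKernel_eq_fockWeyl (w : ℂ) : fockKernel w = fockWeyl (-w) fun _ => 1 := by
  ext z
  simp [fockKernel, fockWeyl]

theorem memFock_fockKernel (w : ℂ) : MemFock (fockKernel w) :=
  fockKernel_eq_fockWeyl w ▸ (memFock_const 1).fockWeyl (-w)

theorem fockNormSq_fockKernel (w : ℂ) : fockNormSq (fockKernel w) = Real.exp (‖w‖ ^ 2) := by
  simp [fockKernel_eq_fockWeyl, fockNormSq_fockWeyl, fockNormSq_const]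

theorem FockBoundedOp.sq_norm_mul_exp_le {u ψ : ℂ → ℂ} (hbdd : FockBoundedOp (wComp u ψ)) :
    ∃ C : ℝ, 0 < C ∧ ∀ w, ‖u w‖ ^ 2 * Real.exp (‖ψ w‖ ^ 2) ≤ C * Real.exp (‖w‖ ^ 2) := by
  obtain ⟨hmap, C, hC, hle⟩ := hbdd
  refine ⟨C + 1, by positivity, fun w => ?_⟩
  have hmem := memFock_fockKernel (ψ w)
  have h1 := (hmap _ hmem).sq_norm_apply_le w
  have h2 := hle _ hmem
  rw [fockNormSq_fockKernel] at h2
  have h3 : ‖wComp u ψ (fockKernel (ψ w)) w‖ ^ 2 =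
      ‖u w‖ ^ 2 * Real.exp (‖ψ w‖ ^ 2) * Real.exp (‖ψ w‖ ^ 2) := by
    rw [wComp, fockKernel, Complex.mul_conj, Complex.normSq_eq_norm_sq, norm_mul,
      Complex.norm_exp, Complex.ofReal_re]
    ring
  refine le_of_mul_le_mul_right ?_ (Real.exp_pos (‖ψ w‖ ^ 2))
  rw [← h3]
  calc _ ≤ Real.exp (‖w‖ ^ 2) * fockNormSq (wComp u ψ (fockKernel (ψ w))) := h1
    _ ≤ Real.exp (‖w‖ ^ 2) * ((C + 1) * Real.exp (‖ψ w‖ ^ 2)) := by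
      gcongr
      exact h2.trans (by gcongr; linarith)
    _ = _ := by ring

theorem exists_le_circleAverage_log_norm {u : ℂ → ℂ} (hu : Differentiable ℂ u) :
    ∃ L : ℝ, ∀ R : ℝ, 1 ≤ R → L ≤ Real.circleAverage (Real.log ‖u ·‖) 0 R := by
  refine ⟨Real.log ‖meromorphicTrailingCoeffAt u 0‖, fun R hR => ?_⟩
  have han : AnalyticOnNhd ℂ u (Metric.closedBall 0 |R|) := fun z _ => hu.analyticAt z
  have hdiv (z : ℂ) :
      (0 : ℝ) ≤ (MeromorphicOn.divisor u (Metric.closedBall 0 |R|) z : ℝ) :=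
    mod_cast MeromorphicOn.AnalyticOnNhd.divisor_nonneg han z
  rw [han.meromorphicOn.circleAverage_log_norm (by positivity)]
  have hsum : 0 ≤ ∑ᶠ z, (MeromorphicOn.divisor u (Metric.closedBall 0 |R|) z : ℝ) *
      Real.log (R * ‖(0 : ℂ) - z‖⁻¹) := by
    refine finsum_nonneg fun z => ?_
    by_cases hz : z ∈ Metric.closedBall (0 : ℂ) |R|
    · refine mul_nonneg (hdiv z) ?_
      rcases eq_or_ne z 0 with rfl | hz0
      · simp
      · refine Real.log_nonneg ?_
        rw [mem_closedBall_zero_iff, abs_of_nonneg (by positivity)] at hz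
        rw [zero_sub, norm_neg, ← div_eq_mul_inv, one_le_div (norm_pos_iff.2 hz0)]
        exact hz
    · simp [Function.locallyFinsuppWithin.apply_eq_zero_of_notMem _ hz]
  have := mul_nonneg (hdiv 0) (Real.log_nonneg hR)
  linarith

theorem exists_circleAverage_sq_norm_le {u ψ : ℂ → ℂ} (hu : Differentiable ℂ u)
    (hψ : Differentiable ℂ ψ) {z₀ : ℂ} (hz₀ : u z₀ ≠ 0) {C : ℝ} (hC : 0 < C)
    (hle : ∀ w, ‖u w‖ ^ 2 * Real.exp (‖ψ w‖ ^ 2) ≤ C * Real.exp (‖w‖ ^ 2)) :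
    ∃ M : ℝ, ∀ R : ℝ, 1 ≤ R → Real.circleAverage (fun w => ‖ψ w‖ ^ 2) 0 R ≤ R ^ 2 + M := by
  obtain ⟨L, hL⟩ := exists_le_circleAverage_log_norm hu
  refine ⟨Real.log C - 2 * L, fun R hR => ?_⟩
  set g : ℂ → ℝ := fun w => Real.log C + R ^ 2 - 2 * Real.log ‖u w‖ with hg
  have hψc := hψ.continuous
  have hlog : CircleIntegrable (Real.log ‖u ·‖) 0 R :=
    MeromorphicOn.circleIntegrable_log_norm fun z _ => (hu.analyticAt z).meromorphicAt
  have hlog2 : CircleIntegrable (fun w => 2 * Real.log ‖u w‖) 0 R := hlog.const_smul (a := (2 : ℝ))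
  have hgint : CircleIntegrable g 0 R := (circleIntegrable_const _ _ _).sub hlog2
  set g' : ℂ → ℝ := fun w => if u w = 0 then ‖ψ w‖ ^ 2 else g w with hg'
  have hgg' : g =ᶠ[Filter.codiscreteWithin (Metric.sphere 0 |R|)] g' := by
    have h1 : u ⁻¹' {0}ᶜ ∈ Filter.codiscreteWithin (Set.univ : Set ℂ) :=
      AnalyticOnNhd.preimage_zero_mem_codiscreteWithin (fun z _ => hu.analyticAt z) hz₀
        (Set.mem_univ _) isConnected_univ
    filter_upwards [Filter.codiscreteWithin_mono (Set.subset_univ _) h1] with w hw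
    have hw : u w ≠ 0 := hw
    simp [hg', hw]
  calc Real.circleAverage (fun w => ‖ψ w‖ ^ 2) 0 R ≤ Real.circleAverage g' 0 R := by
        refine Real.circleAverage_mono ?_ (hgint.congr_codiscreteWithin hgg') fun w hw => ?_
        · exact (by fun_prop : Continuous fun w => ‖ψ w‖ ^ 2).continuousOn.circleIntegrable'
        · by_cases h0 : u w = 0
          · simp [hg', h0]
          · have hpos : 0 < ‖u w‖ := norm_pos_iff.2 h0
            have h1 := Real.log_le_log (by positivity) (hle w)
            rw [Real.log_mul (by positivity) (by positivity),
              Real.log_mul (by positivity) (by positivity), Real.log_exp, Real.log_exp,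
              Real.log_pow, mem_sphere_zero_iff_norm.1 hw, sq_abs] at h1
            simp only [hg', hg, h0, if_false]
            push_cast at h1
            linarith
    _ = Real.circleAverage g 0 R :=
        (Real.circleAverage_congr_codiscreteWithin hgg' (by positivity)).symm
    _ = Real.log C + R ^ 2 - 2 * Real.circleAverage (Real.log ‖u ·‖) 0 R := by
        rw [hg, Real.circleAverage_fun_sub (circleIntegrable_const _ _ _) hlog2,
          Real.circleAverage_const]
        congr 1
        exact Real.circleAverage_fun_smul (a := (2 : ℝ))
    _ ≤ _ := by linarith [hL R hR]

theorem exists_affine_of_circleAverage_sq_norm_le {ψ : ℂ → ℂ} (hψ : Differentiable ℂ ψ) {M : ℝ}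
    (hM : ∀ R : ℝ, 1 ≤ R → Real.circleAverage (fun w => ‖ψ w‖ ^ 2) 0 R ≤ R ^ 2 + M) :
    ∃ a b : ℂ, ∀ z, ψ z = a * z + b := by
  have hψc := hψ.continuous
  have hser (R : NNReal) (hR : 0 < R) := hψ.hasFPowerSeriesOnBall 0 hR
  set p := cauchyPowerSeries ψ 0 (1 : NNReal)
  have hzero (n : ℕ) (hn : 2 ≤ n) : p n = 0 := by
    have hbound (R : ℝ) (hR : 1 ≤ R) : ‖p n‖ ≤ (1 + |M|) * R⁻¹ := by
      have hR0 : 0 < R := by positivity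
      have h1 : p = cauchyPowerSeries ψ 0 R :=
        (hser 1 one_pos).hasFPowerSeriesAt.eq_formalMultilinearSeries
          (hser ⟨R, hR0.le⟩ hR0).hasFPowerSeriesAt
      have h2 : Real.circleAverage (fun w => ‖ψ w‖) 0 R ≤ R * (1 + |M|) := by
        have hi : CircleIntegrable (fun w => (2 * R)⁻¹ * ‖ψ w‖ ^ 2 + R / 2) 0 R :=
          (by fun_prop : Continuous fun w => (2 * R)⁻¹ * ‖ψ w‖ ^ 2 + R / 2)
            |>.continuousOn.circleIntegrable'
        have hi' : CircleIntegrable (fun w => (2 * R)⁻¹ * ‖ψ w‖ ^ 2) 0 R :=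
          (by fun_prop : Continuous fun w => (2 * R)⁻¹ * ‖ψ w‖ ^ 2)
            |>.continuousOn.circleIntegrable'
        calc _ ≤ Real.circleAverage (fun w => (2 * R)⁻¹ * ‖ψ w‖ ^ 2 + R / 2) 0 R := by
              refine Real.circleAverage_mono
                (by fun_prop : Continuous fun w => ‖ψ w‖).continuousOn.circleIntegrable' hi ?_
              intro w _
              have := sq_nonneg (‖ψ w‖ - R)
              field_simp
              linarith
          _ = (2 * R)⁻¹ * Real.circleAverage (fun w => ‖ψ w‖ ^ 2) 0 R + R / 2 := by
              rw [Real.circleAverage_fun_add hi' (circleIntegrable_const _ _ _),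
                Real.circleAverage_const]
              congr 1
              exact Real.circleAverage_fun_smul (a := (2 * R)⁻¹)
          _ ≤ (2 * R)⁻¹ * (R ^ 2 + M) + R / 2 := by gcongr; exact hM R hR
          _ ≤ R * (1 + |M|) := by
              have h3 : M ≤ R ^ 2 * |M| :=
                (le_abs_self M).trans (le_mul_of_one_le_left (abs_nonneg M) (one_le_pow₀ hR))
              have := abs_nonneg M
              field_simp
              nlinarith [mul_nonneg (sq_nonneg R) this]
      calc ‖p n‖ ≤ Real.circleAverage (fun w => ‖ψ w‖) 0 R * |R|⁻¹ ^ n :=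
            h1 ▸ norm_cauchyPowerSeries_le ψ 0 R n
        _ ≤ R * (1 + |M|) * R⁻¹ ^ 2 := by
            rw [abs_of_pos hR0]
            gcongr ?_ * ?_
            exact pow_le_pow_of_le_one (by positivity) (inv_le_one_of_one_le₀ hR) hn
        _ = _ := by field_simp
    have hlim : Filter.Tendsto (fun R : ℝ => (1 + |M|) * R⁻¹) Filter.atTop (nhds 0) := by
      simpa using tendsto_inv_atTop_zero.const_mul (1 + |M|)
    refine norm_le_zero_iff.1 (ge_of_tendsto hlim ?_)
    filter_upwards [Filter.eventually_ge_atTop 1] with R hR using hbound R hR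
  refine ⟨p.coeff 1, p.coeff 0, fun z => ?_⟩
  have h1 := (hser 1 one_pos).hasSum (y := z) (by simp)
  have h2 : HasSum (fun n => p n fun _ => z) (∑ n ∈ Finset.range 2, p n fun _ => z) :=
    hasSum_sum_of_ne_finset_zero fun n hn => by
      rw [hzero n (by simpa [Nat.succ_le_iff] using hn)]
      rfl
  have h3 := h1.unique h2
  simp only [zero_add] at h3
  rw [h3]
  simp [Finset.sum_range_succ]
  ring

theorem MemFock.iterate {T : (ℂ → ℂ) → ℂ → ℂ} (hT : ∀ f, MemFock f → MemFock (T f)) {f : ℂ → ℂ}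
    (hf : MemFock f) (n : ℕ) : MemFock (T^[n] f) := by
  induction n with
  | zero => exact hf
  | succ n ih => exact Function.iterate_succ_apply' T n f ▸ hT _ ih

/-- The values of a dense orbit at a point are dense in `ℂ`. -/
theorem exists_norm_iterate_apply_sub_lt {T : (ℂ → ℂ) → ℂ → ℂ}
    (hT : ∀ f, MemFock f → MemFock (T f)) {f : ℂ → ℂ} (hf : MemFock f)
    (hdense : ∀ g, MemFock g → ∀ ε : ℝ, 0 < ε → ∃ n : ℕ, fockNormSq (fun z => T^[n] f z - g z) < ε)
    (z c : ℂ) {δ : ℝ} (hδ : 0 < δ) : ∃ n : ℕ, ‖T^[n] f z - c‖ < δ := by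
  obtain ⟨n, hn⟩ := hdense _ (memFock_const c) (δ ^ 2 * Real.exp (-‖z‖ ^ 2)) (by positivity)
  refine ⟨n, lt_of_pow_lt_pow_left₀ 2 hδ.le ?_⟩
  calc _ ≤ Real.exp (‖z‖ ^ 2) * fockNormSq (fun z => T^[n] f z - c) :=
        ((hf.iterate hT n).sub (memFock_const c)).sq_norm_apply_le z
    _ < Real.exp (‖z‖ ^ 2) * (δ ^ 2 * Real.exp (-‖z‖ ^ 2)) := by gcongr
    _ = δ ^ 2 := by
        rw [mul_left_comm, ← Real.exp_add]
        simp

theorem exists_lt_norm_iterate_apply {T : (ℂ → ℂ) → ℂ → ℂ}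
    (hT : ∀ f, MemFock f → MemFock (T f)) {f : ℂ → ℂ} (hf : MemFock f)
    (hdense : ∀ g, MemFock g → ∀ ε : ℝ, 0 < ε → ∃ n : ℕ, fockNormSq (fun z => T^[n] f z - g z) < ε)
    (z : ℂ) (B : ℝ) : ∃ n : ℕ, B < ‖T^[n] f z‖ := by
  obtain ⟨n, hn⟩ := exists_norm_iterate_apply_sub_lt hT hf hdense z ((|B| + 1 : ℝ) : ℂ) one_pos
  refine ⟨n, ?_⟩
  have h1 := norm_sub_norm_le ((|B| + 1 : ℝ) : ℂ) (T^[n] f z)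
  rw [norm_sub_rev, Complex.norm_real, Real.norm_of_nonneg (by positivity)] at h1
  linarith [le_abs_self B]

theorem wComp_iterate_apply_of_fixedPt {u ψ : ℂ → ℂ} {z : ℂ} (hz : ψ z = z) (f : ℂ → ℂ) (n : ℕ) :
    (wComp u ψ)^[n] f z = u z ^ n * f z := by
  induction n with
  | zero => simp
  | succ n ih =>
    rw [Function.iterate_succ_apply', wComp, hz, ih]
    ring

theorem not_isHypercyclicOp_wComp_of_fixedPt {u ψ : ℂ → ℂ}
    (hT : ∀ f, MemFock f → MemFock (wComp u ψ f)) {z : ℂ} (hz : ψ z = z) :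
    ¬ IsHypercyclicOp (wComp u ψ) := by
  rintro ⟨f, hf, hdense⟩
  obtain ⟨n, hn⟩ := exists_lt_norm_iterate_apply hT hf hdense z ‖f z‖
  rw [wComp_iterate_apply_of_fixedPt hz, norm_mul, norm_pow] at hn
  have hfz : 0 < ‖f z‖ := by
    by_contra! h
    rw [norm_le_zero_iff.1 h] at hn
    simp at hn
  have hu : 1 ≤ ‖u z‖ := by
    by_contra! h
    exact hn.not_ge (mul_le_of_le_one_left hfz.le (pow_le_one₀ (norm_nonneg _) h.le))
  obtain ⟨m, hm⟩ := exists_norm_iterate_apply_sub_lt hT hf hdense z 0 hfz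
  rw [wComp_iterate_apply_of_fixedPt hz, sub_zero, norm_mul, norm_pow] at hm
  exact hm.not_ge (le_mul_of_one_le_left hfz.le (one_le_pow₀ hu))

theorem not_isHypercyclicOp_of_fockNormSq_eq {T : (ℂ → ℂ) → ℂ → ℂ}
    (hT : ∀ f, MemFock f → MemFock (T f)) {K : ℝ} (hK : 0 ≤ K)
    (hTK : ∀ f, fockNormSq (T f) = K * fockNormSq f) : ¬ IsHypercyclicOp T := by
  rintro ⟨f, hf, hdense⟩
  have hiter (n : ℕ) : fockNormSq (T^[n] f) = K ^ n * fockNormSq f := by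
    induction n with
    | zero => simp
    | succ n ih =>
      rw [Function.iterate_succ_apply', hTK, ih]
      ring
  obtain ⟨n, hn⟩ := exists_lt_norm_iterate_apply hT hf hdense 0 (√(fockNormSq f))
  have h1 : fockNormSq f < K ^ n * fockNormSq f :=
    hiter n ▸ ((Real.sqrt_lt' ((Real.sqrt_nonneg _).trans_lt hn)).1 hn).trans_le
      (hf.iterate hT n).sq_norm_apply_zero_le
  have hfpos : 0 < fockNormSq f := by
    refine (fockNormSq_nonneg f).lt_of_ne fun h => ?_
    simp [← h] at h1
  have hK1 : 1 ≤ K := by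
    by_contra! h
    exact h1.not_ge (mul_le_of_le_one_left hfpos.le (pow_le_one₀ hK h.le))
  obtain ⟨m, hm⟩ := hdense _ (memFock_const 0) _ hfpos
  simp only [sub_zero] at hm
  rw [hiter] at hm
  exact hm.not_ge (le_mul_of_one_le_left hfpos.le (one_le_pow₀ hK1))

theorem fockNormSq_const_mul (c : ℂ) (f : ℂ → ℂ) :
    fockNormSq (fun z => c * f z) = ‖c‖ ^ 2 * fockNormSq f := by
  simp only [fockNormSq, norm_mul, mul_pow, mul_assoc]
  rw [integral_const_mul]
  ring

theorem wComp_eq_const_mul_fockWeyl {u ψ : ℂ → ℂ} (hu : Differentiable ℂ u) {b : ℂ}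
    (hψ : ∀ z, ψ z = z + b) {C : ℝ}
    (hle : ∀ w, ‖u w‖ ^ 2 * Real.exp (‖ψ w‖ ^ 2) ≤ C * Real.exp (‖w‖ ^ 2)) (f : ℂ → ℂ) :
    wComp u ψ f = fun z => u 0 * fockWeyl b f z := by
  set g : ℂ → ℂ := fun z => u z * Complex.exp (z * (starRingEnd ℂ) b) with hg
  have hgd : Differentiable ℂ g := by fun_prop
  have hgle (z : ℂ) : ‖g z‖ ^ 2 ≤ C := by
    have h1 : ‖z + b‖ ^ 2 = ‖z‖ ^ 2 + 2 * (z * (starRingEnd ℂ) b).re + ‖b‖ ^ 2 := by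
      simp only [Complex.sq_norm, Complex.normSq_apply, Complex.mul_re, Complex.conj_re,
        Complex.conj_im, Complex.add_re, Complex.add_im]
      ring
    have h2 := hle z
    rw [hψ, h1] at h2
    refine le_of_mul_le_mul_right ?_ (Real.exp_pos (‖z‖ ^ 2))
    calc ‖g z‖ ^ 2 * Real.exp (‖z‖ ^ 2)
        = ‖u z‖ ^ 2 * Real.exp (‖z‖ ^ 2 + 2 * (z * (starRingEnd ℂ) b).re) := by
          rw [hg, norm_mul, Complex.norm_exp, mul_pow, ← Real.exp_nat_mul, Real.exp_add]
          push_cast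
          ring
      _ ≤ ‖u z‖ ^ 2 * Real.exp (‖z‖ ^ 2 + 2 * (z * (starRingEnd ℂ) b).re + ‖b‖ ^ 2) := by
          refine mul_le_mul_of_nonneg_left (Real.exp_le_exp.2 ?_) (sq_nonneg _)
          exact le_add_of_nonneg_right (sq_nonneg _)
      _ ≤ _ := h2
  have hbdd : Bornology.IsBounded (Set.range g) := by
    refine isBounded_iff_forall_norm_le.2 ⟨√C, ?_⟩
    rintro _ ⟨z, rfl⟩
    exact Real.le_sqrt_of_sq_le (hgle z)
  ext z
  have h0 : g z = g 0 := hgd.apply_eq_apply_of_bounded hbdd z 0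
  simp only [hg, zero_mul, Complex.exp_zero, mul_one] at h0
  rw [wComp, fockWeyl, hψ, ← h0, mul_mul_mul_comm, Complex.exp_neg, mul_right_comm, mul_assoc]
  field_simp

/-- no bounded weighted composition operator on 𝓕₂ is hypercyclic. -/
theorem weighted_composition_not_hypercyclic (u ψ : ℂ → ℂ)
    (hu : Differentiable ℂ u) (hψ : Differentiable ℂ ψ)
    (hbdd : FockBoundedOp (wComp u ψ)) :
    ¬ IsHypercyclicOp (wComp u ψ) := by
  obtain ⟨C, hC, hle⟩ := hbdd.sq_norm_mul_exp_le
  by_cases hu0 : ∀ z, u z = 0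
  · refine not_isHypercyclicOp_of_fockNormSq_eq hbdd.1 le_rfl fun f => ?_
    have h0 : wComp u ψ f = fun _ => 0 := by
      ext z
      simp [wComp, hu0]
    simp [h0, fockNormSq_const]
  push Not at hu0
  obtain ⟨z₀, hz₀⟩ := hu0
  obtain ⟨M, hM⟩ := exists_circleAverage_sq_norm_le hu hψ hz₀ hC hle
  obtain ⟨a, b, hab⟩ := exists_affine_of_circleAverage_sq_norm_le hψ hM
  by_cases ha : a = 1
  · refine not_isHypercyclicOp_of_fockNormSq_eq hbdd.1
      (K := ‖u 0‖ ^ 2 * Real.exp (‖b‖ ^ 2)) (by positivity) fun f => ?_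
    rw [wComp_eq_const_mul_fockWeyl hu (by simpa [ha] using hab) hle, fockNormSq_const_mul,
      fockNormSq_fockWeyl, mul_assoc]
  · refine not_isHypercyclicOp_wComp_of_fixedPt hbdd.1 (z := b / (1 - a)) ?_
    have : 1 - a ≠ 0 := sub_ne_zero.2 (Ne.symm ha)
    rw [hab]
    field_simp
    ring
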